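/- Let f_1, …, f_l be monotone, normalized, submodular set functions on subsets of a finite ground set V with f_i({j}) > 0 for all i and j, and let κ ∈ [0,1] satisfy f_i(V) − f_i(V∖{j}) ≥ (1−κ)·f_i({j}) for every i and j. Then for every nonempty X ⊆ V: max_{i=1:l} f_i(X) ≤ max_{i=1:l} Σ_{j∈X} f_i({j}) ≤ K(|X|, κ) · max_{i=1:l} f_i(X), where K(p, κ) = p / (1 + (1−κ)(p−1)). -/

import Mathlib

/-- A normalized submodular function is bounded above by the sum of its singleton values. -/
theorem submodular_le_sum_singleton {V : Type*} [DecidableEq V] (g : Finset V → ℝ)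
    (hsub : ∀ S T : Finset V, g S + g T ≥ g (S ∪ T) + g (S ∩ T)) (hnorm : g ∅ = 0)
    (X : Finset V) : g X ≤ ∑ j ∈ X, g {j} := by
  induction X using Finset.induction_on with
  | empty => simp [hnorm]
  | insert a s ha ih =>
    have h := hsub {a} s
    rw [Finset.singleton_inter_of_notMem ha, hnorm, ← Finset.insert_eq] at h
    rw [Finset.sum_insert ha]
    linarith

/-- If every marginal at the top is at least `c` times the singleton value, then adding a
disjoint set `B` to `A` increases a submodular function by at least `c * ∑ j ∈ B, g {j}`. -/
theorem submodular_add_mul_sum_le_union {V : Type*} [Fintype V] [DecidableEq V]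
    (g : Finset V → ℝ) (hsub : ∀ S T : Finset V, g S + g T ≥ g (S ∪ T) + g (S ∩ T)) (c : ℝ)
    (hcurv : ∀ j : V, g Finset.univ - g (Finset.univ.erase j) ≥ c * g {j})
    (A B : Finset V) (hAB : Disjoint B A) : g A + c * ∑ j ∈ B, g {j} ≤ g (B ∪ A) := by
  induction B using Finset.induction_on with
  | empty => simp
  | insert a s ha ih =>
    rw [Finset.disjoint_insert_left] at hAB
    have h := hsub (insert a s ∪ A) (Finset.univ.erase a)
    have hunion : insert a s ∪ A ∪ Finset.univ.erase a = Finset.univ := by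
      ext x
      by_cases hx : x = a <;> simp [hx]
    have hinter : (insert a s ∪ A) ∩ Finset.univ.erase a = s ∪ A := by
      ext x
      by_cases hx : x = a
      · simp [hx, ha, hAB.1]
      · simp [hx]
    rw [hunion, hinter] at h
    rw [Finset.sum_insert ha]
    linarith [ih hAB.2, hcurv a]

/-- Under the same marginal bound, the sum of the singleton values over `X` is at most
`|X| / (1 + c * (|X| - 1))` times the value at `X`, in division-free form. -/
theorem submodular_mul_sum_singleton_le_card_mul {V : Type*} [Fintype V] [DecidableEq V]
    (g : Finset V → ℝ) (hsub : ∀ S T : Finset V, g S + g T ≥ g (S ∪ T) + g (S ∩ T)) (c : ℝ)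
    (hcurv : ∀ j : V, g Finset.univ - g (Finset.univ.erase j) ≥ c * g {j}) (X : Finset V) :
    (1 + c * ((X.card : ℝ) - 1)) * ∑ j ∈ X, g {j} ≤ X.card * g X := by
  have h : ∑ j ∈ X, (g {j} + c * (∑ k ∈ X, g {k} - g {j})) ≤ ∑ _j ∈ X, g X := by
    refine Finset.sum_le_sum fun j hj => ?_
    have h1 := submodular_add_mul_sum_le_union g hsub c hcurv {j} (X.erase j) (by simp)
    rw [Finset.union_comm, ← Finset.insert_eq, Finset.insert_erase hj] at h1
    rwa [← Finset.add_sum_erase X (fun k => g {k}) hj, add_sub_cancel_left]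
  rw [Finset.sum_add_distrib, ← Finset.mul_sum, Finset.sum_sub_distrib] at h
  simp only [Finset.sum_const, nsmul_eq_mul] at h
  linarith

/-- For monotone normalized submodular functions `f 0, …, f (l-1)` with positive
singleton values and common curvature bound `κ`, for every nonempty `X`:
`max_i f i X ≤ max_i ∑_{j∈X} f i {j} ≤ K(|X|, κ) · max_i f i X`,
where `K(p, κ) = p / (1 + (1−κ)(p−1))`. -/
theorem curvature_modular_upper_bound_max {V : Type*} [Fintype V] [DecidableEq V]
    (l : ℕ) (hl : 0 < l)
    (f : Fin l → Finset V → ℝ)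
    (hsub : ∀ i (S T : Finset V), f i S + f i T ≥ f i (S ∪ T) + f i (S ∩ T))
    (hmono : ∀ i (S T : Finset V), S ⊆ T → f i S ≤ f i T)
    (hnorm : ∀ i, f i ∅ = 0)
    (hpos : ∀ i (j : V), 0 < f i {j})
    (κ : ℝ) (hκ0 : 0 ≤ κ) (hκ1 : κ ≤ 1)
    (hcurv : ∀ i (j : V), f i Finset.univ - f i (Finset.univ.erase j) ≥ (1 - κ) * f i {j})
    (X : Finset V) (hX : X.Nonempty) :
    Finset.univ.sup' ⟨⟨0, hl⟩, Finset.mem_univ _⟩ (fun i => f i X) ≤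
      Finset.univ.sup' ⟨⟨0, hl⟩, Finset.mem_univ _⟩ (fun i => ∑ j ∈ X, f i {j}) ∧
    Finset.univ.sup' ⟨⟨0, hl⟩, Finset.mem_univ _⟩ (fun i => ∑ j ∈ X, f i {j}) ≤
      ((X.card : ℝ) / (1 + (1 - κ) * ((X.card : ℝ) - 1))) *
        Finset.univ.sup' ⟨⟨0, hl⟩, Finset.mem_univ _⟩ (fun i => f i X) := by
  constructor
  · exact Finset.sup'_mono_fun fun i _ =>
      submodular_le_sum_singleton (f i) (hsub i) (hnorm i) X
  · have hcard : (1 : ℝ) ≤ X.card := by exact_mod_cast hX.card_pos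
    have hden : 0 < 1 + (1 - κ) * ((X.card : ℝ) - 1) := by
      have := mul_nonneg (sub_nonneg.2 hκ1) (sub_nonneg.2 hcard)
      linarith
    refine Finset.sup'_le _ _ fun i hi => ?_
    calc ∑ j ∈ X, f i {j}
        ≤ (X.card : ℝ) / (1 + (1 - κ) * ((X.card : ℝ) - 1)) * f i X := by
          rw [div_mul_eq_mul_div, le_div_iff₀ hden, mul_comm]
          exact submodular_mul_sum_singleton_le_card_mul (f i) (hsub i) _ (hcurv i) X
      _ ≤ _ := mul_le_mul_of_nonneg_left (Finset.le_sup' (fun i => f i X) hi) (by positivity)
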